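/- Let G be a prevariety of group languages over a finite alphabet A and let L be a regular language. Then L belongs to UPol(BPol(G)) if and only if the G-kernel N of the syntactic morphism of L belongs to DA, i.e., (st)^ω = (st)^ω · t · (st)^ω for all s, t ∈ N. -/

import Mathlib

/- Common definitions: languages over a finite alphabet, classes of languages,
prevarieties, polynomial closure and its variants, separation, C-pairs, etc. -/

namespace RegLang

variable {A : Type}

/-- A language over the alphabet `A`: a set of finite words. -/
abbrev Lang (A : Type) := Set (FreeMonoid A)

/-- A class of languages over the alphabet `A`. -/
abbrev LangClass (A : Type) := Set (Lang A)

/-- A lattice of languages: contains `∅` and `A*` and is closed under binary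
union and intersection. -/
def IsLatticeClass (C : LangClass A) : Prop :=
  ∅ ∈ C ∧ (Set.univ : Lang A) ∈ C ∧
    (∀ K L : Lang A, K ∈ C → L ∈ C → K ∪ L ∈ C) ∧
    (∀ K L : Lang A, K ∈ C → L ∈ C → K ∩ L ∈ C)

/-- A Boolean algebra of languages: a lattice of languages closed under complement. -/
def IsBooleanAlgebraClass (C : LangClass A) : Prop :=
  IsLatticeClass C ∧ ∀ L ∈ C, Lᶜ ∈ C

/-- A class is quotient-closed if it is closed under left and right quotients by words. -/
def QuotientClosed (C : LangClass A) : Prop :=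
  ∀ L ∈ C, ∀ u : FreeMonoid A,
    {w : FreeMonoid A | u * w ∈ L} ∈ C ∧ {w : FreeMonoid A | w * u ∈ L} ∈ C

/-- A language is regular if it is a preimage of a subset under a monoid morphism
into a finite monoid. -/
def IsRegularLang (L : Lang A) : Prop :=
  ∃ (M : Type) (_ : Monoid M) (_ : Finite M) (φ : FreeMonoid A →* M) (F : Set M),
    L = φ ⁻¹' F

/-- A positive prevariety: a quotient-closed lattice of regular languages. -/
def IsPositivePrevariety (C : LangClass A) : Prop :=
  IsLatticeClass C ∧ QuotientClosed C ∧ ∀ L ∈ C, IsRegularLang L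

/-- A prevariety: a quotient-closed Boolean algebra of regular languages. -/
def IsPrevariety (C : LangClass A) : Prop :=
  IsBooleanAlgebraClass C ∧ QuotientClosed C ∧ ∀ L ∈ C, IsRegularLang L

/-- The marked concatenation `KaL = {uav : u ∈ K, v ∈ L}`. -/
def MarkedCat (K : Lang A) (a : A) (L : Lang A) : Lang A :=
  {w | ∃ u ∈ K, ∃ v ∈ L, w = u * FreeMonoid.of a * v}

/-- A marked concatenation `KaL` is unambiguous if every word of `KaL` has a
unique factorization `uav` with `u ∈ K` and `v ∈ L`. -/
def Unambiguous (K : Lang A) (a : A) (L : Lang A) : Prop :=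
  ∀ u u' v v' : FreeMonoid A, u ∈ K → u' ∈ K → v ∈ L → v' ∈ L →
    u * FreeMonoid.of a * v = u' * FreeMonoid.of a * v' → u = u' ∧ v = v'

/-- The marked concatenation `KaL` is left deterministic: `K ∩ KaA* = ∅`. -/
def LeftDeterministic (K : Lang A) (a : A) (_L : Lang A) : Prop :=
  K ∩ MarkedCat K a Set.univ = ∅

/-- The marked concatenation `KaL` is right deterministic: `L ∩ A*aL = ∅`. -/
def RightDeterministic (_K : Lang A) (a : A) (L : Lang A) : Prop :=
  L ∩ MarkedCat Set.univ a L = ∅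

/-- Polynomial closure: the least class containing `C` and closed under binary
union and marked concatenation. -/
inductive Pol (C : LangClass A) : Lang A → Prop
  | base {L : Lang A} : L ∈ C → Pol C L
  | union {K L : Lang A} : Pol C K → Pol C L → Pol C (K ∪ L)
  | mcat {K L : Lang A} (a : A) : Pol C K → Pol C L → Pol C (MarkedCat K a L)

/-- `coPol C`: the class of complements of languages in `Pol C`. -/
def coPol (C : LangClass A) : LangClass A := {L | ∃ K : Lang A, Pol C K ∧ L = Kᶜ}

/-- `BPol C`: the least Boolean algebra of languages containing `Pol C`. -/
inductive BPol (C : LangClass A) : Lang A → Prop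
  | base {L : Lang A} : Pol C L → BPol C L
  | empty : BPol C ∅
  | univ : BPol C Set.univ
  | union {K L : Lang A} : BPol C K → BPol C L → BPol C (K ∪ L)
  | inter {K L : Lang A} : BPol C K → BPol C L → BPol C (K ∩ L)
  | compl {L : Lang A} : BPol C L → BPol C Lᶜ

/-- Unambiguous polynomial closure: the least class containing `C` and closed
under disjoint union and unambiguous marked concatenation. -/
inductive UPol (C : LangClass A) : Lang A → Prop
  | base {L : Lang A} : L ∈ C → UPol C L
  | disjUnion {K L : Lang A} : UPol C K → UPol C L → K ∩ L = ∅ → UPol C (K ∪ L)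
  | mcat {K L : Lang A} (a : A) : UPol C K → UPol C L → Unambiguous K a L →
      UPol C (MarkedCat K a L)

/-- Alternated polynomial closure: the least class containing `C` and closed under
disjoint union and left- and right-deterministic marked concatenation. -/
inductive APol (C : LangClass A) : Lang A → Prop
  | base {L : Lang A} : L ∈ C → APol C L
  | disjUnion {K L : Lang A} : APol C K → APol C L → K ∩ L = ∅ → APol C (K ∪ L)
  | leftCat {K L : Lang A} (a : A) : APol C K → APol C L → LeftDeterministic K a L →
      APol C (MarkedCat K a L)
  | rightCat {K L : Lang A} (a : A) : APol C K → APol C L → RightDeterministic K a L →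
      APol C (MarkedCat K a L)

/-- `KaL` is left `C`-deterministic: there are `K', L' ∈ C` with `K ⊆ K'`, `L ⊆ L'`
and `K'aL'` left deterministic. -/
def LeftCDeterministic (C : LangClass A) (K : Lang A) (a : A) (L : Lang A) : Prop :=
  ∃ K' ∈ C, ∃ L' ∈ C, K ⊆ K' ∧ L ⊆ L' ∧ LeftDeterministic K' a L'

/-- `KaL` is right `C`-deterministic: there are `K', L' ∈ C` with `K ⊆ K'`, `L ⊆ L'`
and `K'aL'` right deterministic. -/
def RightCDeterministic (C : LangClass A) (K : Lang A) (a : A) (L : Lang A) : Prop :=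
  ∃ K' ∈ C, ∃ L' ∈ C, K ⊆ K' ∧ L ⊆ L' ∧ RightDeterministic K' a L'

/-- Weak alternated polynomial closure: the least class containing `C` and closed under
disjoint union and left- and right-`C`-deterministic marked concatenation. -/
inductive WAPol (C : LangClass A) : Lang A → Prop
  | base {L : Lang A} : L ∈ C → WAPol C L
  | disjUnion {K L : Lang A} : WAPol C K → WAPol C L → K ∩ L = ∅ → WAPol C (K ∪ L)
  | leftCat {K L : Lang A} (a : A) : WAPol C K → WAPol C L →
      LeftCDeterministic C K a L → WAPol C (MarkedCat K a L)
  | rightCat {K L : Lang A} (a : A) : WAPol C K → WAPol C L →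
      RightCDeterministic C K a L → WAPol C (MarkedCat K a L)

/-- `K` separates `L₁` from `L₂`. -/
def Separates (K L₁ L₂ : Lang A) : Prop := L₁ ⊆ K ∧ K ∩ L₂ = ∅

/-- `L₁` is `C`-separable from `L₂`. -/
def Separable (C : LangClass A) (L₁ L₂ : Lang A) : Prop := ∃ K ∈ C, Separates K L₁ L₂

/-- `(s, t)` is a `C`-pair for `φ`: `φ⁻¹(s)` is not `C`-separable from `φ⁻¹(t)`. -/
def CPair (C : LangClass A) {M : Type} [Monoid M] (φ : FreeMonoid A →* M)
    (s t : M) : Prop :=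
  ¬ Separable C (φ ⁻¹' {s}) (φ ⁻¹' {t})

/-- The canonical `C`-preorder on `M` associated with `φ`. -/
def CPreorder (C : LangClass A) {M : Type} [Monoid M] (φ : FreeMonoid A →* M)
    (s t : M) : Prop :=
  ∀ F : Set M, φ ⁻¹' F ∈ C → s ∈ F → t ∈ F

/-- The canonical `C`-equivalence on `M` associated with `φ`. -/
def CEquiv (C : LangClass A) {M : Type} [Monoid M] (φ : FreeMonoid A →* M)
    (s t : M) : Prop :=
  ∀ F : Set M, φ ⁻¹' F ∈ C → (s ∈ F ↔ t ∈ F)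

/-- A `C`-morphism: a surjective morphism all of whose recognized languages are in `C`. -/
def IsCMorphism (C : LangClass A) {N : Type} [Monoid N] (η : FreeMonoid A →* N) : Prop :=
  Function.Surjective η ∧ ∀ F : Set N, η ⁻¹' F ∈ C

/-- `e` is the idempotent power `s^ω` of `s`: an idempotent of the form `s^n`, `n ≥ 1`
(in a finite monoid such an element exists and is unique). -/
def IsIdempotentPower {M : Type} [Monoid M] (s e : M) : Prop :=
  IsIdempotentElem e ∧ ∃ n : ℕ, 1 ≤ n ∧ e = s ^ n

/-- The `C`-kernel of `φ`: the elements `s` such that `{ε}` is not `C`-separable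
from `φ⁻¹(s)`. -/
def gKernel (C : LangClass A) {M : Type} [Monoid M] (φ : FreeMonoid A →* M) : Set M :=
  {s | ¬ Separable C ({1} : Lang A) (φ ⁻¹' {s})}

/-- The strict `C`-kernel of `φ`: the intersection of the `C`-kernel with `φ(A⁺)`. -/
def strictGKernel (C : LangClass A) {M : Type} [Monoid M]
    (φ : FreeMonoid A →* M) : Set M :=
  gKernel C φ ∩ φ '' {w : FreeMonoid A | w ≠ 1}

/-- A group language: one recognized by a morphism into a finite group. -/
def IsGroupLanguage (L : Lang A) : Prop :=
  ∃ (G : Type) (_ : Group G) (_ : Finite G) (φ : FreeMonoid A →* G) (F : Set G),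
    L = φ ⁻¹' F

/-- A prevariety of group languages. -/
def IsGroupPrevariety (G : LangClass A) : Prop :=
  IsPrevariety G ∧ ∀ L ∈ G, IsGroupLanguage L

/-- The well-suited extension `G⁺`: all languages `L ∩ A⁺` and `L ∪ {ε}` for `L ∈ G`. -/
def wellSuited (G : LangClass A) : LangClass A :=
  {L | ∃ K ∈ G, L = K ∩ {w : FreeMonoid A | w ≠ 1} ∨ L = K ∪ ({1} : Lang A)}

/-- `le` is a partial order on the monoid `N` compatible with multiplication. -/
def IsCompatiblePartialOrder {N : Type} [Monoid N] (le : N → N → Prop) : Prop :=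
  (∀ x, le x x) ∧ (∀ x y z, le x y → le y z → le x z) ∧
    (∀ x y, le x y → le y x → x = y) ∧
    (∀ x x' y y', le x y → le x' y' → le (x * x') (y * y'))

/-- `F` is upward closed for the relation `le`. -/
def UpClosed {N : Type} (le : N → N → Prop) (F : Set N) : Prop :=
  ∀ s ∈ F, ∀ t, le s t → t ∈ F

/-- An ordered `C`-morphism: a surjective morphism onto a finite ordered monoid such
that preimages of upward closed sets are in `C`. -/
def IsOrderedCMorphism (C : LangClass A) {N : Type} [Monoid N]
    (η : FreeMonoid A →* N) (le : N → N → Prop) : Prop :=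
  Function.Surjective η ∧ IsCompatiblePartialOrder le ∧
    ∀ F : Set N, UpClosed le F → η ⁻¹' F ∈ C

/-- The syntactic preorder of `L`: `u ≼_L v` iff `xuy ∈ L → xvy ∈ L` for all `x, y`. -/
def SynPre (L : Lang A) (u v : FreeMonoid A) : Prop :=
  ∀ x y : FreeMonoid A, x * u * y ∈ L → x * v * y ∈ L

/-- `φ` is (a copy of) the syntactic morphism of `L`: it is surjective and identifies
exactly the words that are syntactically congruent for `L`. -/
def IsSyntacticMorphism (L : Lang A) {M : Type} [Monoid M]
    (φ : FreeMonoid A →* M) : Prop :=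
  Function.Surjective φ ∧
    ∀ u v : FreeMonoid A, φ u = φ v ↔ ∀ x y : FreeMonoid A, (x * u * y ∈ L ↔ x * v * y ∈ L)

/-- `le` is (a copy of) the syntactic order of `L` on the target of `φ`. -/
def IsSyntacticOrder (L : Lang A) {M : Type} [Monoid M] (φ : FreeMonoid A →* M)
    (le : M → M → Prop) : Prop :=
  ∀ u v : FreeMonoid A, le (φ u) (φ v) ↔ SynPre L u v

/-! ### Factorizations of words -/

theorem mul_eq_marked {x y k l : FreeMonoid A} {a : A} (h : x * y = k * FreeMonoid.of a * l) :
    (∃ r, x = k * FreeMonoid.of a * r ∧ l = r * y) ∨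
      ∃ r, k = x * r ∧ y = r * FreeMonoid.of a * l := by
  have h' : FreeMonoid.toList x ++ FreeMonoid.toList y
      = FreeMonoid.toList k ++ a :: FreeMonoid.toList l := by
    have := congrArg FreeMonoid.toList h
    simpa [FreeMonoid.toList_mul] using this
  rcases List.append_eq_append_iff.1 h' with ⟨r, h1, h2⟩ | ⟨r, h1, h2⟩
  · refine Or.inr ⟨FreeMonoid.ofList r, h1, ?_⟩
    rw [mul_assoc]
    exact h2
  · cases r with
    | nil =>
      refine Or.inr ⟨1, ?_, ?_⟩
      · rw [mul_one]
        simpa using h1.symm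
      · rw [one_mul]
        exact h2.symm
    | cons b r =>
      simp only [List.cons_append, List.cons.injEq] at h2
      obtain ⟨rfl, h2⟩ := h2
      refine Or.inl ⟨FreeMonoid.ofList r, ?_, h2⟩
      rw [mul_assoc]
      exact h1

theorem mul_pow_mul_eq_marked {a : A} (w y k l : FreeMonoid A) (n : ℕ) (x : FreeMonoid A)
    (h : x * w ^ n * y = k * FreeMonoid.of a * l) :
    (∃ r, x = k * FreeMonoid.of a * r ∧ l = r * w ^ n * y) ∨
      (∃ i j w₁ w₂, i + 1 + j = n ∧ w = w₁ * FreeMonoid.of a * w₂ ∧ k = x * w ^ i * w₁ ∧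
        l = w₂ * w ^ j * y) ∨
      ∃ r, k = x * w ^ n * r ∧ y = r * FreeMonoid.of a * l := by
  induction n generalizing x with
  | zero =>
    rcases mul_eq_marked h with ⟨r, h1, h2⟩ | h
    · exact Or.inl ⟨r, by simpa using h1, by simpa using h2⟩
    · exact Or.inr (Or.inr h)
  | succ n ih =>
    have h0 : x * w * w ^ n * y = k * FreeMonoid.of a * l := by
      rw [← h, pow_succ']
      simp only [mul_assoc]
    rcases ih (x * w) h0 with ⟨r, h1, h2⟩ | ⟨i, j, w₁, w₂, h1, h2, h3, h4⟩ | ⟨r, h1, h2⟩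
    · rcases mul_eq_marked h1 with ⟨r', h3, h4⟩ | ⟨r', h3, h4⟩
      · refine Or.inl ⟨r', h3, ?_⟩
        rw [h2, h4, pow_succ']
        simp only [mul_assoc]
      · refine Or.inr (Or.inl ⟨0, n, r', r, by omega, h4, ?_, h2⟩)
        rw [h3, pow_zero, mul_one]
    · refine Or.inr (Or.inl ⟨i + 1, j, w₁, w₂, by omega, h2, ?_, h4⟩)
      rw [h3, pow_succ']
      simp only [mul_assoc]
    · refine Or.inr (Or.inr ⟨r, ?_, h2⟩)
      rw [h1, pow_succ']
      simp only [mul_assoc]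

theorem exists_isIdempotentPower {M : Type} [Monoid M] [Finite M] (x : M) :
    ∃ n : ℕ, 1 ≤ n ∧ IsIdempotentElem (x ^ n) := by
  obtain ⟨i, j, hij, h⟩ : ∃ i j : ℕ, i < j ∧ x ^ (i + 1) = x ^ (j + 1) := by
    obtain ⟨i, j, hne, h⟩ := Finite.exists_ne_map_eq_of_infinite fun i : ℕ => x ^ (i + 1)
    rcases lt_or_gt_of_ne hne with hlt | hlt
    · exact ⟨i, j, hlt, h⟩
    · exact ⟨j, i, hlt, h.symm⟩
  obtain ⟨d, rfl⟩ := Nat.exists_eq_add_of_lt hij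
  have hper : ∀ m, i + 1 ≤ m → ∀ k, x ^ (m + k * (d + 1)) = x ^ m := by
    intro m hm k
    induction k with
    | zero => simp
    | succ k ih =>
      obtain ⟨c, hc⟩ := Nat.exists_eq_add_of_le hm
      calc x ^ (m + (k + 1) * (d + 1)) = x ^ (i + d + 1 + 1) * x ^ (c + k * (d + 1)) := by
            rw [← pow_add]
            congr 1
            rw [hc]
            ring
        _ = x ^ (i + 1) * x ^ (c + k * (d + 1)) := by rw [h]
        _ = x ^ (m + k * (d + 1)) := by
            rw [← pow_add]
            congr 1
            rw [hc]
            ring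
        _ = x ^ m := ih
  refine ⟨(i + 1) * (d + 1), Nat.mul_pos i.succ_pos d.succ_pos, ?_⟩
  rw [IsIdempotentElem, ← pow_add]
  exact hper _ (Nat.le_mul_of_pos_right _ d.succ_pos) _

/-! ### Finite operations in a prevariety -/

theorem IsLatticeClass.sInter_mem {C : LangClass A} (hC : IsLatticeClass C)
    {F : Set (Lang A)} (hF : F.Finite) (h : F ⊆ C) : ⋂₀ F ∈ C := by
  induction F, hF using Set.Finite.induction_on with
  | empty => simpa using hC.2.1
  | @insert K F _ _ ih =>
    rw [Set.sInter_insert]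
    exact hC.2.2.2 _ _ (h (Set.mem_insert _ _)) (ih fun L hL => h (Set.mem_insert_of_mem _ hL))

theorem IsLatticeClass.iUnion_mem {C : LangClass A} (hC : IsLatticeClass C) {ι : Type*}
    [Finite ι] (K : ι → Lang A) (h : ∀ i, K i ∈ C) : (⋃ i, K i) ∈ C := by
  have key : ∀ F : Set (Lang A), F.Finite → F ⊆ C → ⋃₀ F ∈ C := by
    intro F hF hFC
    induction F, hF using Set.Finite.induction_on with
    | empty => simpa using hC.1
    | @insert K F _ _ ih =>
      rw [Set.sUnion_insert]
      exact hC.2.2.1 _ _ (hFC (Set.mem_insert _ _))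
        (ih fun L hL => hFC (Set.mem_insert_of_mem _ hL))
  rw [← Set.sUnion_range]
  exact key _ (Set.finite_range K) (Set.range_subset_iff.2 h)

theorem IsLatticeClass.iInter_mem {C : LangClass A} (hC : IsLatticeClass C) {ι : Type*}
    [Finite ι] (K : ι → Lang A) (h : ∀ i, K i ∈ C) : (⋂ i, K i) ∈ C := by
  rw [← Set.sInter_range]
  exact hC.sInter_mem (Set.finite_range K) (Set.range_subset_iff.2 h)

/-- The syntactic congruence of a language. -/
def synCon (L : Lang A) : Con (FreeMonoid A) where
  r u v := ∀ x y : FreeMonoid A, x * u * y ∈ L ↔ x * v * y ∈ L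
  iseqv := ⟨fun _ _ _ => Iff.rfl, fun h x y => (h x y).symm,
    fun h h' x y => (h x y).trans (h' x y)⟩
  mul' := by
    intro u v u' v' h h' x y
    have h1 := h x (u' * y)
    have h2 := h' (x * v) y
    simp only [mul_assoc] at h1 h2 ⊢
    exact h1.trans h2

theorem synCon_iff {L : Lang A} {u v : FreeMonoid A} :
    synCon L u v ↔ ∀ x y : FreeMonoid A, x * u * y ∈ L ↔ x * v * y ∈ L := Iff.rfl

theorem IsPrevariety.synCon_class_mem {C : LangClass A} (hC : IsPrevariety C) {L : Lang A}
    (hL : L ∈ C) (u : FreeMonoid A) : {w | synCon L w u} ∈ C := by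
  obtain ⟨hB, hQ, hR⟩ := hC
  obtain ⟨M, _, _, φ, F, rfl⟩ := hR L hL
  let S : FreeMonoid A × FreeMonoid A → Lang A := fun p =>
    {w | p.1 * w * p.2 ∈ φ ⁻¹' F ↔ p.1 * u * p.2 ∈ φ ⁻¹' F}
  have hfin : (Set.range S).Finite := by
    have hsub : Set.range S ⊆ Set.range fun q : M × M =>
        ({w | q.1 * φ w * q.2 ∈ F ↔ q.1 * φ u * q.2 ∈ F} : Lang A) := by
      rintro _ ⟨p, rfl⟩
      refine ⟨(φ p.1, φ p.2), ?_⟩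
      ext w
      simp [S]
    exact (Set.finite_range _).subset hsub
  have hmem : Set.range S ⊆ C := by
    rintro _ ⟨p, rfl⟩
    have h1 : {w : FreeMonoid A | p.1 * w * p.2 ∈ φ ⁻¹' F} ∈ C :=
      (hQ _ (hQ _ hL p.2).2 p.1).1
    by_cases hu : p.1 * u * p.2 ∈ φ ⁻¹' F
    · have : S p = {w : FreeMonoid A | p.1 * w * p.2 ∈ φ ⁻¹' F} := by
        ext w
        exact iff_true_right hu
      rwa [this]
    · have : S p = {w : FreeMonoid A | p.1 * w * p.2 ∈ φ ⁻¹' F}ᶜ := by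
        ext w
        exact iff_false_right hu
      rw [this]
      exact hB.2 _ h1
  have := hB.1.sInter_mem hfin hmem
  convert this using 1
  ext w
  simp only [Set.mem_sInter, Set.forall_mem_range, Prod.forall]
  rfl

/-! ### Languages in `UPol (BPol C)` satisfy the identities -/

/-- Membership in `L` is insensitive to replacing a large power of `u * v` by
two large powers separated by `v`, for all `u, v ∈ H`. -/
def FlexAt (H : Submonoid (FreeMonoid A)) (p : ℕ) (L : Lang A) : Prop :=
  ∀ u ∈ H, ∀ v ∈ H, ∀ (x y : FreeMonoid A) (n m k : ℕ), p ≤ n → p ≤ m → p ≤ k →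
    (x * (u * v) ^ n * y ∈ L ↔ x * (u * v) ^ m * v * (u * v) ^ k * y ∈ L)

/-- Some `FlexAt` property holds for a submonoid in `C`. -/
def Flex (C : LangClass A) (L : Lang A) : Prop :=
  ∃ H : Submonoid (FreeMonoid A), (H : Lang A) ∈ C ∧ ∃ p, FlexAt H p L

/-- `L` is stable under insertion of words of `H`, and large powers of words of `H` can be
decreased. -/
def InsertAt (H : Submonoid (FreeMonoid A)) (p : ℕ) (L : Lang A) : Prop :=
  (∀ w ∈ H, ∀ x y : FreeMonoid A, x * y ∈ L → x * w * y ∈ L) ∧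
    ∀ w ∈ H, ∀ (x y : FreeMonoid A) (n : ℕ), p ≤ n →
      x * w ^ (n + 1) * y ∈ L → x * w ^ n * y ∈ L

theorem FlexAt.mono {H H' : Submonoid (FreeMonoid A)} {p p' : ℕ} {L : Lang A}
    (h : FlexAt H p L) (hH : H' ≤ H) (hp : p ≤ p') : FlexAt H' p' L :=
  fun u hu v hv x y n m k hn hm hk =>
    h u (hH hu) v (hH hv) x y n m k (hp.trans hn) (hp.trans hm) (hp.trans hk)

theorem FlexAt.pow_iff {H : Submonoid (FreeMonoid A)} {p : ℕ} {L : Lang A}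
    (h : FlexAt H p L) {u v : FreeMonoid A} (hu : u ∈ H) (hv : v ∈ H) (x y : FreeMonoid A)
    {n m : ℕ} (hn : p ≤ n) (hm : p ≤ m) :
    x * (u * v) ^ n * y ∈ L ↔ x * (u * v) ^ m * y ∈ L :=
  (h u hu v hv x y n p p hn le_rfl le_rfl).trans
    (h u hu v hv x y m p p hm le_rfl le_rfl).symm

theorem InsertAt.mono {H H' : Submonoid (FreeMonoid A)} {p p' : ℕ} {L : Lang A}
    (h : InsertAt H p L) (hH : H' ≤ H) (hp : p ≤ p') : InsertAt H' p' L :=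
  ⟨fun w hw => h.1 w (hH hw), fun w hw x y n hn => h.2 w (hH hw) x y n (hp.trans hn)⟩

theorem InsertAt.pow {H : Submonoid (FreeMonoid A)} {p : ℕ} {L : Lang A}
    (h : InsertAt H p L) {w : FreeMonoid A} (hw : w ∈ H) {x y : FreeMonoid A}
    {n m : ℕ} (hm : p ≤ m) (hL : x * w ^ n * y ∈ L) : x * w ^ m * y ∈ L := by
  have h1 : x * w ^ (m + n) * y ∈ L := by
    rw [pow_add, ← mul_assoc]
    have := h.1 (w ^ m) (pow_mem hw m) x (w ^ n * y) (by rwa [← mul_assoc])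
    rwa [← mul_assoc] at this
  clear hL
  induction n with
  | zero => exact h1
  | succ n ih => exact ih (h.2 w hw x y (m + n) (by omega) h1)

theorem InsertAt.flexAt {H : Submonoid (FreeMonoid A)} {p : ℕ} {L : Lang A}
    (h : InsertAt H p L) : FlexAt H p L := by
  intro u hu v hv x y n m k hn hm hk
  have huv : u * v ∈ H := mul_mem hu hv
  constructor
  · intro hL
    have h1 : x * (u * v) ^ (m + k) * y ∈ L := h.pow huv (by omega) hL
    have := h.1 v hv (x * (u * v) ^ m) ((u * v) ^ k * y) (by simpa [pow_add, mul_assoc] using h1)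
    simpa [mul_assoc] using this
  · intro hL
    have h1 := h.1 u hu (x * (u * v) ^ m) (v * ((u * v) ^ k * y))
      (by simpa [mul_assoc] using hL)
    refine h.pow (n := m + 1 + k) huv hn ?_
    simpa [pow_add, mul_assoc] using h1

theorem Pol.exists_insertAt {C : LangClass A} (hC : IsPrevariety C) {L : Lang A}
    (hL : Pol C L) :
    ∃ H : Submonoid (FreeMonoid A), (H : Lang A) ∈ C ∧ ∃ p, InsertAt H p L := by
  induction hL with
  | @base L hL =>
    refine ⟨⟨⟨{w | synCon L w 1}, ?_⟩, (synCon L).refl 1⟩, hC.synCon_class_mem hL 1, 0, ?_, ?_⟩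
    · intro a b ha hb
      simpa using (synCon L).mul ha hb
    · intro w hw x y hxy
      exact (synCon_iff.1 hw x y).2 (by simpa using hxy)
    · intro w hw x y n _ hxy
      have := (synCon_iff.1 hw (x * w ^ n) y).1 (by simpa [pow_succ, mul_assoc] using hxy)
      simpa using this
  | @union K L _ _ ihK ihL =>
    obtain ⟨H, hH, p, hp⟩ := ihK
    obtain ⟨H', hH', p', hp'⟩ := ihL
    have h1 := hp.mono (inf_le_left : H ⊓ H' ≤ H) (le_max_left p p')
    have h2 := hp'.mono (inf_le_right : H ⊓ H' ≤ H') (le_max_right p p')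
    refine ⟨H ⊓ H', hC.1.1.2.2.2 _ _ hH hH', max p p', ?_, ?_⟩
    · exact fun w hw x y => Or.imp (h1.1 w hw x y) (h2.1 w hw x y)
    · exact fun w hw x y n hn => Or.imp (h1.2 w hw x y n hn) (h2.2 w hw x y n hn)
  | @mcat K L a _ _ ihK ihL =>
    obtain ⟨H, hH, p, hp⟩ := ihK
    obtain ⟨H', hH', p', hp'⟩ := ihL
    have h1 := hp.mono (inf_le_left : H ⊓ H' ≤ H) (le_max_left p p')
    have h2 := hp'.mono (inf_le_right : H ⊓ H' ≤ H') (le_max_right p p')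
    refine ⟨H ⊓ H', hC.1.1.2.2.2 _ _ hH hH', max p p' + max p p' + 1, ?_, ?_⟩
    · rintro w hw x y ⟨k, hk, l, hl, h⟩
      rcases mul_eq_marked h with ⟨r, rfl, rfl⟩ | ⟨r, rfl, rfl⟩
      · exact ⟨k, hk, r * w * y, h2.1 w hw r y hl, by simp only [mul_assoc]⟩
      · exact ⟨x * w * r, h1.1 w hw x r hk, l, hl, by simp only [mul_assoc]⟩
    · rintro w hw x y n hn ⟨k, hk, l, hl, h⟩
      rcases mul_pow_mul_eq_marked _ _ _ _ _ _ h with ⟨r, rfl, rfl⟩ |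
        ⟨i, j, w₁, w₂, hij, hw', rfl, rfl⟩ | ⟨r, rfl, rfl⟩
      · exact ⟨k, hk, _, h2.2 w hw r y n (by omega) hl, by simp only [mul_assoc]⟩
      · have key : ∀ r, w₁ * (FreeMonoid.of a * (w₂ * r)) = w * r := fun r => by
          rw [hw']
          simp only [mul_assoc]
        rcases Nat.lt_or_ge (max p p') i with hi | hi
        · obtain ⟨i, rfl⟩ : ∃ i', i = i' + 1 := ⟨i - 1, by omega⟩
          obtain rfl : n = i + 1 + j := by omega
          refine ⟨_, h1.2 w hw x w₁ i (by omega) hk, _, hl, ?_⟩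
          simp only [mul_assoc, key, pow_add, pow_one]
        · obtain ⟨j, rfl⟩ : ∃ j', j = j' + 1 := ⟨j - 1, by omega⟩
          obtain rfl : n = i + 1 + j := by omega
          refine ⟨_, hk, _, h2.2 w hw w₂ y j (by omega) hl, ?_⟩
          simp only [mul_assoc, key, pow_add, pow_one]
      · exact ⟨_, h1.2 w hw x r n (by omega) hk, l, hl, by simp only [mul_assoc]⟩

theorem FlexAt.and {H H' : Submonoid (FreeMonoid A)} {p p' : ℕ} {K L : Lang A}
    (hK : FlexAt H p K) (hL : FlexAt H' p' L) :
    FlexAt (H ⊓ H') (max p p') K ∧ FlexAt (H ⊓ H') (max p p') L :=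
  ⟨hK.mono inf_le_left (le_max_left _ _), hL.mono inf_le_right (le_max_right _ _)⟩

theorem Flex.union {C : LangClass A} (hC : IsPrevariety C) {K L : Lang A}
    (hK : Flex C K) (hL : Flex C L) : Flex C (K ∪ L) := by
  obtain ⟨H, hH, p, hp⟩ := hK
  obtain ⟨H', hH', p', hp'⟩ := hL
  obtain ⟨h1, h2⟩ := hp.and hp'
  exact ⟨H ⊓ H', hC.1.1.2.2.2 _ _ hH hH', max p p', fun u hu v hv x y n m k hn hm hk =>
    or_congr (h1 u hu v hv x y n m k hn hm hk) (h2 u hu v hv x y n m k hn hm hk)⟩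

theorem Flex.compl {C : LangClass A} {L : Lang A} (hL : Flex C L) : Flex C Lᶜ := by
  obtain ⟨H, hH, p, hp⟩ := hL
  exact ⟨H, hH, p, fun u hu v hv x y n m k hn hm hk =>
    not_congr (hp u hu v hv x y n m k hn hm hk)⟩

theorem BPol.flex {C : LangClass A} (hC : IsPrevariety C) {L : Lang A} (hL : BPol C L) :
    Flex C L := by
  have huniv : Flex C (Set.univ : Lang A) :=
    ⟨⊤, hC.1.1.2.1, 0, fun _ _ _ _ _ _ _ _ _ _ _ _ => Iff.rfl⟩
  induction hL with
  | base h =>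
    obtain ⟨H, hH, p, hp⟩ := h.exists_insertAt hC
    exact ⟨H, hH, p, hp.flexAt⟩
  | empty => simpa using huniv.compl
  | univ => exact huniv
  | union _ _ ihK ihL => exact ihK.union hC ihL
  | inter _ _ ihK ihL => simpa [Set.compl_union] using (ihK.compl.union hC ihL.compl).compl
  | compl _ ih => exact ih.compl

/-- An unambiguous `K a L` cannot contain `x f g f y` with the marker in either copy of `f`. -/
theorem Unambiguous.absurd_marker {K L : Lang A} {a : A}
    (hu : Unambiguous K a L) {x y f g k l : FreeMonoid A}
    (hf : f = k * FreeMonoid.of a * l) (h1 : x * k ∈ K) (h2 : x * f * g * k ∈ K)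
    (h3 : l * y ∈ L) (h4 : l * g * f * y ∈ L) : False := by
  have := (hu (x * k) (x * f * g * k) (l * g * f * y) (l * y) h1 h2 h4 h3 (by
    rw [hf]
    simp only [mul_assoc])).1
  have h5 := congrArg FreeMonoid.length this
  rw [hf] at h5
  simp only [FreeMonoid.length_mul, FreeMonoid.length_of] at h5
  omega

theorem FlexAt.markedCat {H : Submonoid (FreeMonoid A)} {p : ℕ} {K L : Lang A} {a : A}
    (hK : FlexAt H p K) (hL : FlexAt H p L) (hKL : Unambiguous K a L) :
    FlexAt H (p + p + 1) (MarkedCat K a L) := by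
  intro u hu v hv x y n m k hn hm hk
  have fK := hK u hu v hv
  have fL := hL u hu v hv
  have pK := fun x y n m hn hm => (hK.pow_iff hu hv x y (n := n) (m := m) hn hm).1
  have pL := fun x y n m hn hm => (hL.pow_iff hu hv x y (n := n) (m := m) hn hm).1
  generalize u * v = f at fK fL pK pL ⊢
  have key : ∀ w₁ w₂ : FreeMonoid A, f = w₁ * FreeMonoid.of a * w₂ →
      ∀ r, w₁ * (FreeMonoid.of a * (w₂ * r)) = f * r := fun w₁ w₂ h r => by
    rw [h]
    simp only [mul_assoc]
  constructor
  · rintro ⟨k', hk', l, hl, h⟩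
    rcases mul_pow_mul_eq_marked _ _ _ _ _ _ h with ⟨r, rfl, rfl⟩ |
      ⟨i, j, w₁, w₂, hij, hw, rfl, rfl⟩ | ⟨r, rfl, rfl⟩
    · refine ⟨_, hk', _, (fL r y n m k (by omega) (by omega) (by omega)).1 hl, ?_⟩
      simp only [mul_assoc]
    · rcases Nat.lt_or_ge i p with hi | hi
      · obtain ⟨j', rfl⟩ : ∃ j', m = i + 1 + j' := ⟨m - i - 1, by omega⟩
        refine ⟨_, hk', _, (fL w₂ y j j' k (by omega) (by omega) (by omega)).1 hl, ?_⟩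
        simp only [mul_assoc, key _ _ hw, pow_add, pow_one]
      · obtain ⟨j₀, hj₀, hl₀⟩ : ∃ j₀ ≤ p, w₂ * f ^ j₀ * y ∈ L := by
          rcases Nat.lt_or_ge j p with hj | hj
          · exact ⟨j, hj.le, hl⟩
          · exact ⟨p, le_rfl, pL w₂ y j p hj le_rfl hl⟩
        obtain ⟨i', rfl⟩ : ∃ i', k = i' + 1 + j₀ := ⟨k - 1 - j₀, by omega⟩
        refine ⟨_, (fK x w₁ i m i' (by omega) (by omega) (by omega)).1 hk', _, hl₀, ?_⟩
        simp only [mul_assoc, key _ _ hw, pow_add, pow_one]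
    · refine ⟨_, (fK x r n m k (by omega) (by omega) (by omega)).1 hk', _, hl, ?_⟩
      simp only [mul_assoc]
  · rintro ⟨k', hk', l, hl, h⟩
    have h' : x * f ^ m * (v * (f ^ k * y)) = k' * FreeMonoid.of a * l := by
      rw [← h]
      simp only [mul_assoc]
    rcases mul_pow_mul_eq_marked _ _ _ _ _ _ h' with ⟨r, rfl, rfl⟩ |
      ⟨i, j, w₁, w₂, hij, hw, rfl, rfl⟩ | ⟨r, rfl, h1⟩
    · refine ⟨_, hk', _, (fL r y n m k (by omega) (by omega) (by omega)).2 ?_, ?_⟩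
      · simpa only [mul_assoc] using hl
      · simp only [mul_assoc]
    · rcases Nat.lt_or_ge i p with hi | hi
      · obtain ⟨j', rfl⟩ : ∃ j', n = i + 1 + j' := ⟨n - i - 1, by omega⟩
        refine ⟨_, hk', _, (fL w₂ y j' j k (by omega) (by omega) (by omega)).2 ?_, ?_⟩
        · simpa only [mul_assoc] using hl
        · simp only [mul_assoc, key _ _ hw, pow_add, pow_one]
      · have hl' : w₂ * f ^ j * v * f ^ k * y ∈ L := by simpa only [mul_assoc] using hl
        refine (hKL.absurd_marker (x := x * f ^ p) (y := f ^ j * v * f ^ p * y)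
          (g := f ^ j * v * f ^ p) hw (pK _ _ _ _ hi le_rfl hk') ?_ ?_ ?_).elim
        · have := (fK x w₁ i (p + 1 + j) p hi (by omega) le_rfl).1 hk'
          simpa only [mul_assoc, pow_add, pow_one] using this
        · have := pL _ y k p (by omega) le_rfl hl'
          simpa only [mul_assoc] using this
        · have := (fL _ y k (p + 1 + j) p (by omega) (by omega) le_rfl).1 hl'
          simpa only [mul_assoc, pow_add, pow_one] using this
    · rcases mul_eq_marked h1 with ⟨r', rfl, rfl⟩ | ⟨r', rfl, h2⟩
      · rw [← mul_assoc] at hl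
        refine (hKL.absurd_marker (l := r') (x := x * f ^ p) (y := f ^ p * y)
          (g := f ^ p) rfl (pK x r _ _ (by omega) le_rfl hk') ?_ ?_ ?_).elim
        · simpa only [mul_assoc] using
            (fK x r m p p (by omega) le_rfl le_rfl).1 hk'
        · simpa only [mul_assoc] using pL r' y k p (by omega) le_rfl hl
        · simpa only [mul_assoc] using (fL r' y k p p (by omega) le_rfl le_rfl).1 hl
      · rw [← one_mul (f ^ k)] at h2
        have hk₁ : x * f ^ m * v * r' ∈ K := by simpa only [mul_assoc] using hk'
        rcases mul_pow_mul_eq_marked _ _ _ _ _ _ h2 with ⟨r, h3, _⟩ |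
          ⟨i, j, w₁, w₂, hij, hw, rfl, rfl⟩ | ⟨r, rfl, rfl⟩
        · have := congrArg FreeMonoid.length h3
          simp only [FreeMonoid.length_mul, FreeMonoid.length_of, FreeMonoid.length_one] at this
          omega
        · have hk₂ : x * f ^ m * (v * f ^ i * w₁) ∈ K := by
            simpa only [mul_assoc, one_mul] using hk₁
          rcases Nat.lt_or_ge j p with hj | hj
          · obtain ⟨i', rfl⟩ : ∃ i', n = i' + 1 + j := ⟨n - 1 - j, by omega⟩
            refine ⟨_, (fK x w₁ i' m i (by omega) (by omega) (by omega)).2 ?_, _, hl, ?_⟩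
            · simpa only [mul_assoc] using hk₂
            · simp only [mul_assoc, key _ _ hw, pow_add, pow_one]
          · refine (hKL.absurd_marker (x := x * f ^ p * v * f ^ i) (y := f ^ p * y)
              (g := f ^ p * v * f ^ i) hw ?_ ?_ ?_ ?_).elim
            · simpa only [mul_assoc] using pK _ _ m p (by omega) le_rfl hk₂
            · have := (fK x (v * f ^ i * w₁) m p (i + 1 + p) (by omega) le_rfl (by omega)).1 hk₂
              simpa only [mul_assoc, pow_add, pow_one] using this
            · simpa only [mul_assoc] using pL w₂ y j p (by omega) le_rfl hl
            · have := (fL w₂ y j p (i + 1 + p) (by omega) le_rfl (by omega)).1 hl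
              simpa only [mul_assoc, pow_add, pow_one] using this
        · refine ⟨_, (fK x r n m k (by omega) (by omega) (by omega)).2 ?_, _, hl, ?_⟩
          · simpa only [mul_assoc, one_mul] using hk₁
          · simp only [mul_assoc]

theorem UPol.flex {C : LangClass A} (hC : IsPrevariety C) {L : Lang A}
    (hL : UPol {K : Lang A | BPol C K} L) : Flex C L := by
  induction hL with
  | base h => exact BPol.flex hC h
  | disjUnion _ _ _ ihK ihL => exact ihK.union hC ihL
  | mcat a _ _ hu ihK ihL =>
    obtain ⟨H, hH, p, hp⟩ := ihK
    obtain ⟨H', hH', p', hp'⟩ := ihL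
    obtain ⟨h1, h2⟩ := hp.and hp'
    exact ⟨H ⊓ H', hC.1.1.2.2.2 _ _ hH hH', _, h1.markedCat h2 hu⟩

theorem exists_word_of_mem_gKernel {C : LangClass A} {M : Type} [Monoid M]
    {α : FreeMonoid A →* M} {H : Submonoid (FreeMonoid A)} (hH : (H : Lang A) ∈ C) {s : M}
    (hs : s ∈ gKernel C α) : ∃ u ∈ H, α u = s := by
  by_contra hne
  push Not at hne
  refine hs ⟨H, hH, Set.singleton_subset_iff.2 H.one_mem, ?_⟩
  exact Set.eq_empty_of_forall_notMem fun w hw => hne w hw.1 hw.2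

theorem Flex.da {C : LangClass A} {L : Lang A} (hL : Flex C L) {M : Type} [Monoid M]
    {α : FreeMonoid A →* M} (hα : IsSyntacticMorphism L α) {s t e : M} (hs : s ∈ gKernel C α)
    (ht : t ∈ gKernel C α) (he : IsIdempotentPower (s * t) e) : e = e * t * e := by
  obtain ⟨H, hH, p, hp⟩ := hL
  obtain ⟨u, hu, rfl⟩ := exists_word_of_mem_gKernel hH hs
  obtain ⟨v, hv, rfl⟩ := exists_word_of_mem_gKernel hH ht
  obtain ⟨hi, n, hn, rfl⟩ := he
  have hN : p ≤ n * (p + 1) := by nlinarith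
  have h1 : (α u * α v) ^ n = α ((u * v) ^ (n * (p + 1))) := by
    rw [map_pow, map_mul, pow_mul, hi.pow_eq p.succ_ne_zero]
  rw [h1, ← map_mul, ← map_mul, hα.2]
  intro x y
  simpa only [mul_assoc] using hp u hu v hv x y _ _ _ hN hN hN

/-! ### Paths in the Cayley graph of a group quotient -/

theorem snoc_induction {P : FreeMonoid A → Prop} (one : P 1)
    (mul_of : ∀ w a, P w → P (w * FreeMonoid.of a)) (w : FreeMonoid A) : P w :=
  List.reverseRecOn (motive := P) w one fun l a h => mul_of l a h

theorem eq_diff_singleton {β : Type*} {u X : Set β} {e : β} (he : e ∉ u) (hX : u ∪ {e} = X) :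
    u = X \ {e} := by
  rw [← hX, Set.union_sdiff_right, Set.sdiff_singleton_eq_self he]

section Cayley

variable {H : Type} [Group H] (η : FreeMonoid A →* H)

/-- The set of edges used by the path labelled `w` and starting at `h` in the Cayley graph
of `η`. -/
def edges (h : H) (w : FreeMonoid A) : Set (H × A) :=
  {e | ∃ p q, w = p * FreeMonoid.of e.2 * q ∧ h * η p = e.1}

theorem edges_one (h : H) : edges η h 1 = ∅ := by
  refine Set.eq_empty_of_forall_notMem ?_
  rintro e ⟨p, q, h1, _⟩
  have := congrArg FreeMonoid.length h1
  simp only [FreeMonoid.length_mul, FreeMonoid.length_of, FreeMonoid.length_one] at this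
  omega

theorem edges_mul (h : H) (u v : FreeMonoid A) :
    edges η h (u * v) = edges η h u ∪ edges η (h * η u) v := by
  ext e
  constructor
  · rintro ⟨p, q, h1, h2⟩
    rcases mul_eq_marked h1 with ⟨r, h3, h4⟩ | ⟨r, h3, h4⟩
    · exact Or.inl ⟨p, r, h3, h2⟩
    · exact Or.inr ⟨r, q, h4, by rw [← h2, h3, map_mul, mul_assoc]⟩
  · rintro (⟨p, q, rfl, h2⟩ | ⟨p, q, rfl, h2⟩)
    · exact ⟨p, q * v, by simp only [mul_assoc], h2⟩
    · exact ⟨u * p, q, by simp only [mul_assoc], by rw [← h2, map_mul, mul_assoc]⟩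

theorem edges_of (h : H) (a : A) : edges η h (FreeMonoid.of a) = {(h, a)} := by
  ext ⟨g, b⟩
  constructor
  · rintro ⟨p, q, h1, h2⟩
    have h3 := congrArg FreeMonoid.length h1
    simp only [FreeMonoid.length_mul, FreeMonoid.length_of] at h3
    obtain rfl : p = 1 := FreeMonoid.length_eq_zero.1 (by omega)
    obtain rfl : q = 1 := FreeMonoid.length_eq_zero.1 (by omega)
    simp only [one_mul, mul_one] at h1
    have := FreeMonoid.of_injective h1
    simp_all
  · rintro ⟨⟩
    exact ⟨1, 1, by simp, by simp⟩

theorem exists_first_full {h : H} {X : Set (H × A)} (hX : X.Nonempty) (w : FreeMonoid A)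
    (hw : edges η h w = X) :
    ∃ p a q, w = p * FreeMonoid.of a * q ∧ (h * η p, a) ∉ edges η h p ∧
      edges η h (p * FreeMonoid.of a) = X := by
  induction w using snoc_induction with
  | one =>
    rw [edges_one] at hw
    exact absurd hw.symm hX.ne_empty
  | mul_of w a ih =>
    by_cases h1 : edges η h w = X
    · obtain ⟨p, b, q, rfl, h2, h3⟩ := ih h1
      exact ⟨p, b, q * FreeMonoid.of a, by simp only [mul_assoc], h2, h3⟩
    · refine ⟨w, a, 1, by simp, fun h2 => h1 ?_, hw⟩
      rw [← hw, edges_mul, edges_of, Set.union_eq_left.2 (Set.singleton_subset_iff.2 h2)]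

theorem exists_last_full {h : H} {X : Set (H × A)} (hX : X.Nonempty) (w : FreeMonoid A)
    (hw : edges η h w = X) :
    ∃ q a p, w = q * FreeMonoid.of a * p ∧
      (h * η q, a) ∉ edges η (h * η q * η (FreeMonoid.of a)) p ∧
      edges η (h * η q) (FreeMonoid.of a * p) = X := by
  induction w using FreeMonoid.inductionOn' generalizing h with
  | one =>
    rw [edges_one] at hw
    exact absurd hw.symm hX.ne_empty
  | of_mul a w ih =>
    by_cases h1 : edges η (h * η (FreeMonoid.of a)) w = X
    · obtain ⟨q, b, p, rfl, h2, h3⟩ := ih h1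
      refine ⟨FreeMonoid.of a * q, b, p, by simp only [mul_assoc], ?_, ?_⟩
      · simpa only [map_mul, mul_assoc] using h2
      · simpa only [map_mul, mul_assoc] using h3
    · refine ⟨1, a, w, by simp, ?_, by simpa using hw⟩
      simp only [map_one, mul_one]
      refine fun h2 => h1 ?_
      rw [← hw, edges_mul, edges_of, Set.union_eq_right.2 (Set.singleton_subset_iff.2 h2)]

theorem first_full_unique {h : H} {X : Set (H × A)} {p q p' q' : FreeMonoid A} {a a' : A}
    (hp : (h * η p, a) ∉ edges η h p) (hpX : edges η h (p * FreeMonoid.of a) = X)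
    (hp' : (h * η p', a') ∉ edges η h p') (hpX' : edges η h (p' * FreeMonoid.of a') = X)
    (heq : p * FreeMonoid.of a * q = p' * FreeMonoid.of a' * q') :
    p = p' ∧ a = a' ∧ q = q' := by
  have aux : ∀ {p p' r : FreeMonoid A} {a a' : A}, (h * η p, a) ∉ edges η h p →
      edges η h (p * FreeMonoid.of a) = X → edges η h (p' * FreeMonoid.of a') = X →
      p = p' * FreeMonoid.of a' * r → False := by
    intro p p' r a a' h1 h2 h3 h4
    refine h1 ?_
    have h5 : X ⊆ edges η h p := by
      rw [h4, edges_mul, h3]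
      exact Set.subset_union_left
    refine h5 ?_
    rw [← h2, edges_mul, edges_of]
    exact Or.inr rfl
  rw [mul_assoc p] at heq
  rcases mul_eq_marked heq with ⟨r, h1, _⟩ | ⟨r, h1, h2⟩
  · exact (aux hp hpX hpX' h1).elim
  · rcases mul_eq_marked (x := FreeMonoid.of a) h2 with ⟨r', h3, h4⟩ | ⟨r', h3, h4⟩
    · have h5 := congrArg FreeMonoid.length h3
      simp only [FreeMonoid.length_mul, FreeMonoid.length_of] at h5
      obtain rfl : r = 1 := FreeMonoid.length_eq_zero.1 (by omega)
      obtain rfl : r' = 1 := FreeMonoid.length_eq_zero.1 (by omega)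
      simp only [one_mul, mul_one] at h1 h3 h4
      exact ⟨h1.symm, FreeMonoid.of_injective h3, h4.symm⟩
    · refine (aux hp' hpX' hpX (r := r') ?_).elim
      rw [h1, h3, mul_assoc]

theorem last_full_unique {h : H} {X : Set (H × A)} {p q p' q' : FreeMonoid A} {a a' : A}
    (hp : (h * η q, a) ∉ edges η (h * η q * η (FreeMonoid.of a)) p)
    (hpX : edges η (h * η q) (FreeMonoid.of a * p) = X)
    (hp' : (h * η q', a') ∉ edges η (h * η q' * η (FreeMonoid.of a')) p')
    (hpX' : edges η (h * η q') (FreeMonoid.of a' * p') = X)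
    (heq : q * FreeMonoid.of a * p = q' * FreeMonoid.of a' * p') :
    q = q' ∧ a = a' ∧ p = p' := by
  have aux : ∀ {p q p' q' r : FreeMonoid A} {a a' : A},
      (h * η q, a) ∉ edges η (h * η q * η (FreeMonoid.of a)) p →
      edges η (h * η q) (FreeMonoid.of a * p) = X →
      edges η (h * η q') (FreeMonoid.of a' * p') = X → q' = q * FreeMonoid.of a * r →
      p = r * FreeMonoid.of a' * p' → False := by
    intro p q p' q' r a a' h1 h2 h3 h4 h5
    refine h1 ?_
    rw [h5, mul_assoc r, edges_mul]
    refine Or.inr ?_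
    have h6 : h * η q * η (FreeMonoid.of a) * η r = h * η q' := by
      rw [h4, map_mul, map_mul]
      simp only [mul_assoc]
    rw [h6, h3, ← h2, edges_mul, edges_of]
    exact Or.inl rfl
  have heq' := heq
  rw [mul_assoc q] at heq'
  rcases mul_eq_marked heq' with ⟨r, h1, h2⟩ | ⟨r, h1, h2⟩
  · refine (aux hp' hpX' hpX h1 ?_).elim
    rw [h2, mul_assoc]
  · rcases mul_eq_marked (x := FreeMonoid.of a) h2 with ⟨r', h3, h4⟩ | ⟨r', h3, h4⟩
    · have h5 := congrArg FreeMonoid.length h3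
      simp only [FreeMonoid.length_mul, FreeMonoid.length_of] at h5
      obtain rfl : r = 1 := FreeMonoid.length_eq_zero.1 (by omega)
      obtain rfl : r' = 1 := FreeMonoid.length_eq_zero.1 (by omega)
      simp only [one_mul, mul_one] at h1 h3 h4
      exact ⟨h1.symm, FreeMonoid.of_injective h3, h4.symm⟩
    · refine (aux hp hpX hpX' (r := r') ?_ h4).elim
      rw [h1, h3, mul_assoc]

/-! ### Stability -/

variable {M : Type} [Monoid M] (α : FreeMonoid A →* M)

/-- The image under `α` of the kernel of `η` satisfies the identity of `DA`. -/
def KernelDA : Prop :=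
  ∀ u v : FreeMonoid A, η u = 1 → η v = 1 → ∀ n : ℕ, 1 ≤ n →
    IsIdempotentElem ((α u * α v) ^ n) →
    (α u * α v) ^ n = (α u * α v) ^ n * α v * (α u * α v) ^ n

/-- One can return to `s` after reading any path from `h` with edges in `X`. -/
def RStable (X : Set (H × A)) (h : H) (s : M) : Prop :=
  ∀ v, edges η h v ⊆ X → ∃ c, η (v * c) = 1 ∧ s * α (v * c) = s

/-- One can return to `t` after reading backwards any path to `k` with edges in `X`. -/
def LStable (X : Set (H × A)) (k : H) (t : M) : Prop :=
  ∀ h v, h * η v = k → edges η h v ⊆ X → ∃ c, η (c * v) = 1 ∧ α (c * v) * t = t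

variable {η α}

theorem mul_pow_of_mul_eq {s x : M} (h : s * x = s) (n : ℕ) : s * x ^ n = s := by
  induction n with
  | zero => simp
  | succ n ih => rw [pow_succ, ← mul_assoc, ih, h]

theorem pow_mul_of_mul_eq {t x : M} (h : x * t = t) (n : ℕ) : x ^ n * t = t := by
  induction n with
  | zero => simp
  | succ n ih => rw [pow_succ, mul_assoc, h, ih]

theorem exists_right_return [Finite H] {s : M} {w c : FreeMonoid A} (h : s * α (w * c) = s) :
    ∃ c', η (w * c') = 1 ∧ s * α (w * c') = s := by
  have key : w * (c * (w * c) ^ (Nat.card H - 1)) = (w * c) ^ Nat.card H := by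
    rw [← mul_assoc, ← pow_succ', Nat.sub_add_cancel Nat.card_pos]
  refine ⟨c * (w * c) ^ (Nat.card H - 1), ?_, ?_⟩
  · rw [key, map_pow, pow_card_eq_one']
  · rw [key, map_pow, mul_pow_of_mul_eq h]

theorem exists_left_return [Finite H] {t : M} {w c : FreeMonoid A} (h : α (c * w) * t = t) :
    ∃ c', η (c' * w) = 1 ∧ α (c' * w) * t = t := by
  have key : (c * w) ^ (Nat.card H - 1) * c * w = (c * w) ^ Nat.card H := by
    rw [mul_assoc, ← pow_succ, Nat.sub_add_cancel Nat.card_pos]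
  refine ⟨(c * w) ^ (Nat.card H - 1) * c, ?_, ?_⟩
  · rw [key, map_pow, pow_card_eq_one']
  · rw [key, map_pow, pow_mul_of_mul_eq h]

theorem KernelDA.exists_pow [Finite M] (hα : KernelDA η α) {u v : FreeMonoid A} (hu : η u = 1)
    (hv : η v = 1) : ∃ n, IsIdempotentElem ((α u * α v) ^ n) ∧
      (α u * α v) ^ n = (α u * α v) ^ n * α v * (α u * α v) ^ n := by
  obtain ⟨n, hn, he⟩ := exists_isIdempotentPower (α u * α v)
  exact ⟨n, he, hα u v hu hv n hn he⟩

theorem KernelDA.exists_pow' [Finite M] (hα : KernelDA η α) {u v : FreeMonoid A} (hu : η u = 1)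
    (hv : η v = 1) : ∃ n, (α u * α v) ^ n = (α u * α v) ^ n * α u * (α u * α v) ^ n := by
  obtain ⟨n, hn, he⟩ := exists_isIdempotentPower (α u * α v)
  obtain ⟨k, hk, hf⟩ := exists_isIdempotentPower (α v * α u)
  obtain ⟨N, hN⟩ : ∃ N, n * k = N + 1 := ⟨n * k - 1, by have := Nat.mul_pos hn hk; omega⟩
  have he' : IsIdempotentElem ((α u * α v) ^ (N + 1)) := by
    rw [← hN, pow_mul]
    exact he.pow k
  have hf' : IsIdempotentElem ((α v * α u) ^ (N + 1)) := by
    rw [← hN, mul_comm, pow_mul]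
    exact hf.pow n
  have hfs := hα v u hv hu (N + 1) N.succ_pos hf'
  generalize α u = s at *
  generalize α v = t at *
  have hcomm : ∀ m, s * (t * s) ^ m = (s * t) ^ m * s := fun m =>
    (SemiconjBy.pow_right (show SemiconjBy s (t * s) (s * t) from (mul_assoc s t s).symm) m)
  have h1 : s * (t * s) ^ (N + 1) * t * (s * t) ^ N = (s * t) ^ (N + 1) := by
    rw [hcomm, mul_assoc _ s t, mul_assoc, ← pow_succ', he'.eq]
  refine ⟨N + 1, ?_⟩
  calc (s * t) ^ (N + 1) = s * (t * s) ^ (N + 1) * t * (s * t) ^ N := h1.symm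
    _ = s * ((t * s) ^ (N + 1) * s * (t * s) ^ (N + 1)) * t * (s * t) ^ N := by rw [← hfs]
    _ = s * (t * s) ^ (N + 1) * (s * (t * s) ^ (N + 1) * t * (s * t) ^ N) := by
        simp only [mul_assoc]
    _ = (s * t) ^ (N + 1) * s * (s * t) ^ (N + 1) := by rw [h1, hcomm]

theorem KernelDA.rStable [Finite H] [Finite M] (hα : KernelDA η α) {X : Set (H × A)} {h : H}
    {s : M} {w c : FreeMonoid A} (hw : edges η h w = X) (hs : s * α (w * c) = s) :
    RStable η α X h s := by
  obtain ⟨c₂, hc₂, hs₂⟩ := exists_right_return (η := η) hs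
  intro v
  induction v using snoc_induction with
  | one => exact fun _ => ⟨1, by simp, by simp⟩
  | mul_of v a ih =>
    intro hv
    rw [edges_mul, edges_of, Set.union_subset_iff, Set.singleton_subset_iff] at hv
    obtain ⟨c₁, hc₁, hs₁⟩ := ih hv.1
    rw [← hw] at hv
    obtain ⟨p, q, rfl, hp⟩ := hv.2
    have hp : η p = η v := mul_left_cancel hp
    have hS : η (c₁ * p) = 1 := by
      rw [map_mul, hp]
      exact mul_eq_one_comm.1 ((map_mul η v c₁).symm.trans hc₁)
    have hT : η (FreeMonoid.of a * q * c₂ * v) = 1 := by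
      rw [map_mul, ← hp]
      refine mul_eq_one_comm.1 ?_
      rw [← hc₂]
      simp only [map_mul, mul_assoc]
    obtain ⟨n, -, hn⟩ := hα.exists_pow hS hT
    have hloop : s * α v * (α (c₁ * p) * α (FreeMonoid.of a * q * c₂ * v)) = s * α v := by
      calc _ = s * α (v * c₁) * α (p * FreeMonoid.of a * q * c₂) * α v := by
            simp only [map_mul, mul_assoc]
        _ = s * α v := by rw [hs₁, hs₂]
    have hpow := mul_pow_of_mul_eq hloop n
    refine exists_right_return
      (c := q * c₂ * v * (c₁ * p * (FreeMonoid.of a * q * c₂ * v)) ^ n * c₁) ?_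
    calc _ = s * α v * α (FreeMonoid.of a * q * c₂ * v) *
          (α (c₁ * p) * α (FreeMonoid.of a * q * c₂ * v)) ^ n * α c₁ := by
          simp only [map_mul, map_pow, mul_assoc]
      _ = s * α v * (α (c₁ * p) * α (FreeMonoid.of a * q * c₂ * v)) ^ n *
          α (FreeMonoid.of a * q * c₂ * v) *
          (α (c₁ * p) * α (FreeMonoid.of a * q * c₂ * v)) ^ n * α c₁ := by rw [hpow]
      _ = s * α v * ((α (c₁ * p) * α (FreeMonoid.of a * q * c₂ * v)) ^ n *
          α (FreeMonoid.of a * q * c₂ * v) *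
          (α (c₁ * p) * α (FreeMonoid.of a * q * c₂ * v)) ^ n) * α c₁ := by
          simp only [mul_assoc]
      _ = s * α (v * c₁) := by rw [← hn, hpow, map_mul, mul_assoc]
      _ = s := hs₁

theorem KernelDA.lStable [Finite H] [Finite M] (hα : KernelDA η α) {X : Set (H × A)} {g k : H}
    {t : M} {w c : FreeMonoid A} (hk : g * η w = k) (hw : edges η g w = X)
    (ht : α (c * w) * t = t) : LStable η α X k t := by
  obtain ⟨c₂, hc₂, ht₂⟩ := exists_left_return (η := η) ht
  intro h v
  induction v using FreeMonoid.inductionOn' generalizing h with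
  | one => exact fun _ _ => ⟨1, by simp, by simp⟩
  | of_mul a v ih =>
    intro hkv hv
    rw [edges_mul, edges_of, Set.union_subset_iff, Set.singleton_subset_iff] at hv
    obtain ⟨c₁, hc₁, ht₁⟩ := ih _ (by rw [← hkv, map_mul, mul_assoc]) hv.2
    rw [← hw] at hv
    obtain ⟨p, q, rfl, hp⟩ := hv.1
    have hq : η q = η v := by
      have hp : g * η p = h := hp
      rw [← hkv, ← hp] at hk
      simpa only [map_mul, mul_assoc, mul_right_inj] using hk
    have hT : η (q * c₁) = 1 := by
      rw [map_mul, hq]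
      exact mul_eq_one_comm.1 ((map_mul η c₁ v).symm.trans hc₁)
    have hS : η (v * c₂ * p * FreeMonoid.of a) = 1 := by
      rw [mul_assoc, mul_assoc, map_mul, ← hq]
      refine mul_eq_one_comm.1 ?_
      rw [← hc₂]
      simp only [map_mul, mul_assoc]
    obtain ⟨n, hn⟩ := hα.exists_pow' hS hT
    have hloop : α (v * c₂ * p * FreeMonoid.of a) * α (q * c₁) * (α v * t) = α v * t := by
      calc _ = α v * (α (c₂ * (p * FreeMonoid.of a * q)) * (α (c₁ * v) * t)) := by
            simp only [map_mul, mul_assoc]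
        _ = α v * t := by rw [ht₁, ht₂]
    have hpow := pow_mul_of_mul_eq hloop n
    refine exists_left_return
      (c := c₁ * (v * c₂ * p * FreeMonoid.of a * (q * c₁)) ^ n * v * c₂ * p) ?_
    calc _ = α c₁ * ((α (v * c₂ * p * FreeMonoid.of a) * α (q * c₁)) ^ n *
          α (v * c₂ * p * FreeMonoid.of a) * (α v * t)) := by
          simp only [map_mul, map_pow, mul_assoc]
      _ = α c₁ * ((α (v * c₂ * p * FreeMonoid.of a) * α (q * c₁)) ^ n *
          α (v * c₂ * p * FreeMonoid.of a) *
          ((α (v * c₂ * p * FreeMonoid.of a) * α (q * c₁)) ^ n * (α v * t))) := by rw [hpow]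
      _ = α c₁ * ((α (v * c₂ * p * FreeMonoid.of a) * α (q * c₁)) ^ n *
          α (v * c₂ * p * FreeMonoid.of a) *
          (α (v * c₂ * p * FreeMonoid.of a) * α (q * c₁)) ^ n * (α v * t)) := by
          simp only [mul_assoc]
      _ = α (c₁ * v) * t := by rw [← hn, hpow, map_mul, mul_assoc]
      _ = t := ht₁

theorem KernelDA.stable_eq [Finite M] (hα : KernelDA η α) {X : Set (H × A)} {h : H}
    {S T z z' : FreeMonoid A} (hS : edges η h S ⊆ X) (hSst : RStable η α X (h * η S) (α S))
    (hz : edges η (h * η S) z ⊆ X) (hz' : edges η (h * η S) z' ⊆ X) (heq : η z' = η z)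
    (hT : edges η (h * η S * η z) T ⊆ X) (hTst : LStable η α X (h * η S * η z) (α T)) :
    α (S * z' * T) = α (S * z * T) := by
  obtain ⟨c, hc, hc'⟩ := hSst (z * T) (by rw [edges_mul]; exact Set.union_subset hz hT)
  obtain ⟨d, hd, hd'⟩ := hTst h (S * z') (by rw [map_mul, heq, mul_assoc])
    (by rw [edges_mul]; exact Set.union_subset hS hz')
  have hn₁ : η (c * z' * T) = 1 := by
    have : η (c * z' * T) = η c * η (z * T) := by simp only [map_mul, heq, mul_assoc]
    rw [this]
    exact mul_eq_one_comm.1 ((map_mul η (z * T) c).symm.trans hc)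
  have hy : α (S * z' * T) = α (S * z * T) * α (c * z' * T) := by
    calc α (S * z' * T) = α S * α (z' * T) := by simp only [map_mul, mul_assoc]
      _ = α S * α (z * T * c) * α (z' * T) := by rw [hc']
      _ = _ := by simp only [map_mul, mul_assoc]
  have hx : α (S * z * T) = α (S * z * d) * α (S * z' * T) := by
    calc α (S * z * T) = α (S * z) * α T := by simp only [map_mul]
      _ = α (S * z) * (α (d * (S * z')) * α T) := by rw [hd']
      _ = _ := by simp only [map_mul, mul_assoc]
  obtain ⟨n, hid, hn⟩ := hα.exists_pow (map_one η) hn₁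
  have hiter : ∀ m, α (S * z * T) = α (S * z * d) ^ m * α (S * z * T) * α (c * z' * T) ^ m := by
    intro m
    induction m with
    | zero => simp
    | succ m ih =>
      calc α (S * z * T) = α (S * z * d) ^ m * α (S * z * T) * α (c * z' * T) ^ m := ih
        _ = α (S * z * d) ^ m * (α (S * z * d) * (α (S * z * T) * α (c * z' * T))) *
            α (c * z' * T) ^ m := by rw [← hy, ← hx]
        _ = _ := by
          rw [pow_succ, pow_succ']
          simp only [mul_assoc]
  rw [hy]
  simp only [map_one, one_mul] at hn hid
  generalize α (S * z * T) = x at *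
  generalize α (S * z * d) = b at *
  generalize α (c * z' * T) = y at *
  have hper : y ^ n * y = y ^ n := by
    calc y ^ n * y = y ^ n * y ^ n * y := by rw [hid.eq]
      _ = y ^ n * y * y ^ n := by rw [mul_assoc, mul_assoc, (Commute.pow_self y n).eq]
      _ = y ^ n := hn.symm
  calc x * y = b ^ n * x * (y ^ n * y) := by
        conv_lhs => rw [hiter n]
        simp only [mul_assoc]
    _ = x := by rw [hper, ← hiter]

end Cayley

/-! ### Unambiguous decompositions -/

theorem UPol.iUnion {C : LangClass A} (hC : ∅ ∈ C) {ι : Type*} [Finite ι] (K : ι → Lang A)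
    (h : ∀ i, UPol C (K i)) (hd : ∀ i j w, w ∈ K i → w ∈ K j → i = j) : UPol C (⋃ i, K i) := by
  classical
  have := Fintype.ofFinite ι
  have key : ∀ s : Finset ι, UPol C (⋃ i ∈ s, K i) := by
    intro s
    induction s using Finset.induction_on with
    | empty => simpa using UPol.base hC
    | insert i s hi ih =>
      rw [Finset.set_biUnion_insert]
      refine UPol.disjUnion (h i) ih (Set.eq_empty_of_forall_notMem ?_)
      rintro w ⟨hw, hw'⟩
      obtain ⟨j, hj, hw'⟩ := Set.mem_iUnion₂.1 hw'
      exact hi (hd i j w hw hw' ▸ hj)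
  simpa using key Finset.univ

theorem wellFounded_strict {β : Type*} [Finite β] {R : β → β → Prop} (hr : ∀ a, R a a)
    (ht : ∀ a b c, R a b → R b c → R a c) : WellFounded fun a b => R a b ∧ ¬R b a := by
  have h1 : IsTrans β fun a b => R a b ∧ ¬R b a :=
    ⟨fun a b c hab hbc => ⟨ht a b c hab.1 hbc.1, fun hca => hbc.2 (ht c a b hca hab.1)⟩⟩
  have h2 : Std.Irrefl fun a b : β => R a b ∧ ¬R b a := ⟨fun a h => h.2 (hr a)⟩
  exact Finite.wellFounded_of_trans_of_irrefl _

section Decomposition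

variable {H : Type} [Group H] {η : FreeMonoid A →* H} {M : Type} [Monoid M]
  {α : FreeMonoid A →* M} {C : LangClass A} {X : Set (H × A)}

variable (η α) in
/-- The words of given images under `η` and `α` whose path from `h` uses exactly the edges
in `X`. -/
def fullLang (X : Set (H × A)) (h g : H) (m : M) : Lang A :=
  {w | edges η h w = X ∧ η w = g ∧ α w = m}

theorem eq_one_of_edges_eq_empty {h : H} {w : FreeMonoid A} (hw : edges η h w = ∅) : w = 1 := by
  induction w using FreeMonoid.inductionOn' with
  | one => rfl
  | of_mul a w _ =>
    rw [edges_mul, edges_of] at hw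
    exact absurd (Set.union_empty_iff.1 hw).1 (Set.singleton_ne_empty _)

theorem edges_mul_of_full {h : H} {p : FreeMonoid A} {a : A}
    (hp : edges η h p = X \ {(h * η p, a)}) (he : (h * η p, a) ∈ X) :
    (h * η p, a) ∉ edges η h p ∧ edges η h (p * FreeMonoid.of a) = X := by
  refine ⟨by simp [hp], ?_⟩
  rw [edges_mul, edges_of, hp]
  exact Set.sdiff_union_of_subset (Set.singleton_subset_iff.2 he)

theorem edges_of_mul_full {v : H} {p : FreeMonoid A} {a : A}
    (hp : edges η (v * η (FreeMonoid.of a)) p = X \ {(v, a)}) (he : (v, a) ∈ X) :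
    (v, a) ∉ edges η (v * η (FreeMonoid.of a)) p ∧ edges η v (FreeMonoid.of a * p) = X := by
  refine ⟨by simp [hp], ?_⟩
  rw [edges_mul, edges_of, hp]
  exact Set.union_sdiff_cancel (Set.singleton_subset_iff.2 he)

variable [Finite A] [Finite H] [Finite M]

theorem UPol.of_ssubset_edges (hC : ∅ ∈ C)
    (hIH : ∀ Y, Y ⊂ X → ∀ h g m, UPol C (fullLang η α Y h g m)) (h g : H) (f : M → Prop) :
    UPol C {w | edges η h w ⊂ X ∧ η w = g ∧ f (α w)} := by
  have := UPol.iUnion hC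
    (fun i : {Y : Set (H × A) // Y ⊂ X} × {m // f m} => fullLang η α i.1 h g i.2)
    (fun i => hIH _ i.1.2 _ _ _) ?_
  · convert this using 1
    ext w
    simp only [Set.mem_iUnion]
    constructor
    · rintro ⟨h1, h2, h3⟩
      exact ⟨⟨⟨_, h1⟩, ⟨_, h3⟩⟩, rfl, h2, rfl⟩
    · rintro ⟨⟨⟨Y, hY⟩, ⟨m, hm⟩⟩, h1, h2, h3⟩
      dsimp only at h1 h3
      exact ⟨h1 ▸ hY, h2, h3 ▸ hm⟩
  · rintro ⟨⟨Y, hY⟩, ⟨m, hm⟩⟩ ⟨⟨Y', hY'⟩, ⟨m', hm'⟩⟩ w ⟨h1, h2, h3⟩ ⟨h1', h2', h3'⟩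
    dsimp only at h1 h3 h1' h3'
    subst h1 h3 h1' h3'
    rfl

theorem UPol.of_edges_eq_left (hC : ∅ ∈ C) (hX : X.Nonempty)
    (hIH : ∀ Y, Y ⊂ X → ∀ h g m, UPol C (fullLang η α Y h g m)) (h g : H) (f : M → Prop)
    (hstep : ∀ p a, edges η h (p * FreeMonoid.of a) = X →
      UPol C {q | edges η (h * η (p * FreeMonoid.of a)) q ⊆ X ∧
        η (p * FreeMonoid.of a * q) = g ∧ f (α (p * FreeMonoid.of a * q))}) :
    UPol C {w | edges η h w = X ∧ η w = g ∧ f (α w)} := by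
  have := UPol.iUnion hC
    (fun i : H × A × M => ({w | ∃ p q, w = p * FreeMonoid.of i.2.1 * q ∧
      edges η h p = X \ {(h * η p, i.2.1)} ∧ (h * η p, i.2.1) ∈ X ∧ η p = i.1 ∧ α p = i.2.2 ∧
      edges η (h * η (p * FreeMonoid.of i.2.1)) q ⊆ X ∧ η w = g ∧ f (α w)} : Lang A)) ?_ ?_
  · convert this using 1
    ext w
    simp only [Set.mem_iUnion]
    constructor
    · rintro ⟨h1, h2, h3⟩
      obtain ⟨p, a, q, rfl, h4, h5⟩ := exists_first_full η hX w h1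
      refine ⟨(η p, a, α p), p, q, rfl, ?_, ?_, rfl, rfl, ?_, h2, h3⟩
      · rw [edges_mul, edges_of] at h5
        exact eq_diff_singleton h4 h5
      · rw [← h5, edges_mul, edges_of]
        exact Or.inr rfl
      · rw [edges_mul] at h1
        rw [← h1]
        exact Set.subset_union_right
    · rintro ⟨⟨g₁, a, m⟩, p, q, rfl, h4, h5, -, -, h6, h7, h8⟩
      refine ⟨?_, h7, h8⟩
      rw [edges_mul, (edges_mul_of_full h4 h5).2, Set.union_eq_left.2 h6]
  · rintro ⟨g₁, a, m⟩
    dsimp only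
    by_cases hex : ∃ p₀, edges η h p₀ = X \ {(h * η p₀, a)} ∧ (h * η p₀, a) ∈ X ∧
        η p₀ = g₁ ∧ α p₀ = m
    · obtain ⟨p₀, h1, h2, rfl, rfl⟩ := hex
      have hu := UPol.mcat a
        (hIH _ (Set.sdiff_singleton_ssubset.2 h2) h (η p₀) (α p₀))
        (hstep p₀ a (edges_mul_of_full h1 h2).2) ?_
      · convert hu using 1
        ext w
        constructor
        · rintro ⟨p, q, rfl, h3, h4, h5, h6, h7, h8, h9⟩
          refine ⟨p, ⟨h5 ▸ h3, h5, h6⟩, q, ⟨?_, ?_, ?_⟩, rfl⟩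
          · simpa only [map_mul, h5] using h7
          · simpa only [map_mul, h5] using h8
          · simpa only [map_mul, h6] using h9
        · rintro ⟨p, ⟨h3, h5, h6⟩, q, ⟨h7, h8, h9⟩, rfl⟩
          refine ⟨p, q, rfl, h5.symm ▸ h3, h5.symm ▸ h2, h5, h6, ?_, ?_, ?_⟩
          · simpa only [map_mul, h5] using h7
          · simpa only [map_mul, h5] using h8
          · simpa only [map_mul, h6] using h9
      · rintro p p' q q' ⟨h3, h5, -⟩ ⟨h3', h5', -⟩ - - heq
        rw [← h5] at h3 h2
        have h2' := h2
        rw [h5, ← h5'] at h2'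
        rw [← h5'] at h3'
        obtain ⟨h6, h7⟩ := edges_mul_of_full h3 h2
        obtain ⟨h6', h7'⟩ := edges_mul_of_full h3' h2'
        obtain ⟨r1, -, r2⟩ := first_full_unique η h6 h7 h6' h7' heq
        exact ⟨r1, r2⟩
    · convert UPol.base hC
      refine Set.eq_empty_of_forall_notMem ?_
      rintro w ⟨p, q, -, h1, h2, h3, h4, -⟩
      exact hex ⟨p, h1, h2, h3, h4⟩
  · rintro ⟨g₁, a, m⟩ ⟨g₂, a', m'⟩ w ⟨p, q, rfl, h1, h2, h3, h4, -⟩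
      ⟨p', q', heq, h1', h2', h3', h4', -⟩
    obtain ⟨h5, h6⟩ := edges_mul_of_full h1 h2
    obtain ⟨h5', h6'⟩ := edges_mul_of_full h1' h2'
    obtain ⟨rfl, h7, -⟩ := first_full_unique η h5 h6 h5' h6' heq
    dsimp only at h3 h4 h3' h4' h7
    rw [← h3, ← h4, ← h3', ← h4', h7]

theorem UPol.of_edges_eq_right (hC : ∅ ∈ C) (hX : X.Nonempty)
    (hIH : ∀ Y, Y ⊂ X → ∀ h g m, UPol C (fullLang η α Y h g m)) (h g : H) (f : M → Prop)
    (hstep : ∀ v a p, edges η v (FreeMonoid.of a * p) = X →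
      v * η (FreeMonoid.of a * p) = h * g →
      UPol C {q | edges η h q ⊆ X ∧ h * η q = v ∧ f (α (q * (FreeMonoid.of a * p)))}) :
    UPol C {w | edges η h w = X ∧ η w = g ∧ f (α w)} := by
  have := UPol.iUnion hC
    (fun i : H × A × M => ({w | ∃ q p, w = q * FreeMonoid.of i.2.1 * p ∧
      edges η (i.1 * η (FreeMonoid.of i.2.1)) p = X \ {(i.1, i.2.1)} ∧ (i.1, i.2.1) ∈ X ∧
      η p = (i.1 * η (FreeMonoid.of i.2.1))⁻¹ * (h * g) ∧ α p = i.2.2 ∧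
      edges η h q ⊆ X ∧ h * η q = i.1 ∧ f (α w)} : Lang A)) ?_ ?_
  · convert this using 1
    ext w
    simp only [Set.mem_iUnion]
    constructor
    · rintro ⟨h1, h2, h3⟩
      obtain ⟨q, a, p, rfl, h4, h5⟩ := exists_last_full η hX w h1
      refine ⟨(h * η q, a, α p), q, p, rfl, ?_, ?_, ?_, rfl, ?_, rfl, h3⟩
      · rw [edges_mul, edges_of, Set.union_comm] at h5
        exact eq_diff_singleton h4 h5
      · rw [← h5, edges_mul, edges_of]
        exact Or.inl rfl
      · rw [← h2]
        simp only [map_mul]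
        group
      · rw [mul_assoc, edges_mul] at h1
        rw [← h1]
        exact Set.subset_union_left
    · rintro ⟨⟨v, a, m⟩, q, p, rfl, h4, h5, h6, -, h7, h8, h9⟩
      dsimp only at h4 h5 h6 h8
      refine ⟨?_, ?_, h9⟩
      · rw [mul_assoc, edges_mul, h8, (edges_of_mul_full h4 h5).2, Set.union_eq_right.2 h7]
      · rw [map_mul, map_mul, h6, ← h8]
        group
  · rintro ⟨v, a, m⟩
    dsimp only
    by_cases hex : ∃ p₀, edges η (v * η (FreeMonoid.of a)) p₀ = X \ {(v, a)} ∧ (v, a) ∈ X ∧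
        η p₀ = (v * η (FreeMonoid.of a))⁻¹ * (h * g) ∧ α p₀ = m
    · obtain ⟨p₀, h1, h2, h3, rfl⟩ := hex
      have hu := UPol.mcat a
        (hstep v a p₀ (edges_of_mul_full h1 h2).2 (by rw [map_mul, h3]; group))
        (hIH _ (Set.sdiff_singleton_ssubset.2 h2) (v * η (FreeMonoid.of a)) (η p₀) (α p₀)) ?_
      · convert hu using 1
        ext w
        constructor
        · rintro ⟨q, p, rfl, h4, -, h5, h6, h7, h8, h9⟩
          refine ⟨q, ⟨h7, h8, ?_⟩, p, ⟨h4, h5.trans h3.symm, h6⟩, rfl⟩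
          simpa only [map_mul, h6, mul_assoc] using h9
        · rintro ⟨q, ⟨h7, h8, h9⟩, p, ⟨h4, h5, h6⟩, rfl⟩
          refine ⟨q, p, rfl, h4, h2, h5.trans h3, h6, h7, h8, ?_⟩
          simpa only [map_mul, h6, mul_assoc] using h9
      · rintro q q' p p' ⟨-, h4, -⟩ ⟨-, h4', -⟩ ⟨h5, -, -⟩ ⟨h5', -, -⟩ heq
        obtain ⟨h6, h7⟩ := edges_of_mul_full h5 h2
        obtain ⟨h6', h7'⟩ := edges_of_mul_full h5' h2
        rw [← h4] at h6 h7
        rw [← h4'] at h6' h7'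
        obtain ⟨r1, -, r2⟩ := last_full_unique η h6 h7 h6' h7' heq
        exact ⟨r1, r2⟩
    · convert UPol.base hC
      refine Set.eq_empty_of_forall_notMem ?_
      rintro w ⟨q, p, -, h1, h2, h3, h4, -⟩
      exact hex ⟨p, h1, h2, h3, h4⟩
  · rintro ⟨v, a, m⟩ ⟨v', a', m'⟩ w ⟨q, p, rfl, h1, h2, h3, h4, -, h5, -⟩
      ⟨q', p', heq, h1', h2', h3', h4', -, h5', -⟩
    dsimp only at h1 h2 h3 h4 h5 h1' h2' h3' h4' h5' heq
    obtain ⟨h6, h7⟩ := edges_of_mul_full h1 h2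
    obtain ⟨h6', h7'⟩ := edges_of_mul_full h1' h2'
    rw [← h5] at h6 h7
    rw [← h5'] at h6' h7'
    obtain ⟨rfl, h8, rfl⟩ := last_full_unique η h6 h7 h6' h7' heq
    rw [← h5, ← h5', ← h4, ← h4', h8]

theorem UPol.of_subset_edges (hC : ∅ ∈ C)
    (hIH : ∀ Y, Y ⊂ X → ∀ h g m, UPol C (fullLang η α Y h g m)) {h g : H} {f : M → Prop}
    (hfull : UPol C {w | edges η h w = X ∧ η w = g ∧ f (α w)}) :
    UPol C {w | edges η h w ⊆ X ∧ η w = g ∧ f (α w)} := by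
  convert UPol.disjUnion hfull (UPol.of_ssubset_edges hC hIH h g f) ?_ using 1
  · ext w
    simp only [Set.mem_union, Set.mem_ofPred_eq, ← or_and_right, or_comm (a := edges η h w = X)]
    exact and_congr_left' le_iff_lt_or_eq
  · refine Set.eq_empty_of_forall_notMem ?_
    rintro w ⟨h1, h2⟩
    exact h2.1.ne h1.1

theorem UPol.of_rStable (hα : KernelDA η α) (hsurj : Function.Surjective α) (hC : ∅ ∈ C)
    (hX : X.Nonempty) (hW : ∀ h g, {w | edges η h w ⊆ X ∧ η w = g} ∈ C)
    (hIH : ∀ Y, Y ⊂ X → ∀ h g m, UPol C (fullLang η α Y h g m)) {h : H} {S : FreeMonoid A}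
    (hS : edges η h S ⊆ X) (hSst : RStable η α X (h * η S) (α S)) (m : M) (T : FreeMonoid A)
    (g : H) (hT : edges η (h * η S * g) T ⊆ X) :
    UPol C {z | edges η (h * η S) z ⊆ X ∧ η z = g ∧ α S * α z * α T = m} := by
  have hwf : WellFounded fun t' t : M => (∃ b, t' = b * t) ∧ ¬∃ b, t = b * t' :=
    wellFounded_strict (R := fun t' t : M => ∃ b, t' = b * t) (fun t => ⟨1, (one_mul t).symm⟩) (by
      rintro _ _ t ⟨b, rfl⟩ ⟨c, rfl⟩
      exact ⟨b * c, (mul_assoc b c t).symm⟩)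
  generalize ht : α T = t
  induction t using hwf.induction generalizing T g with
  | _ t ih =>
  subst ht
  by_cases hTst : LStable η α X (h * η S * g) (α T)
  · by_cases hex : ∃ z₀, edges η (h * η S) z₀ ⊆ X ∧ η z₀ = g ∧ α S * α z₀ * α T = m
    · obtain ⟨z₀, hz₀, rfl, rfl⟩ := hex
      refine UPol.base ?_
      convert hW (h * η S) (η z₀) using 1
      ext z
      refine ⟨fun hz => ⟨hz.1, hz.2.1⟩, fun hz => ⟨hz.1, hz.2, ?_⟩⟩
      simpa only [map_mul] using hα.stable_eq hS hSst hz₀ hz.1 hz.2 hT hTst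
    · convert UPol.base hC
      exact Set.eq_empty_of_forall_notMem fun z hz => hex ⟨z, hz⟩
  · refine UPol.of_subset_edges hC hIH (f := fun x => α S * x * α T = m)
      (UPol.of_edges_eq_right hC hX hIH _ _ (fun x => α S * x * α T = m) fun v a p hp hv => ?_)
    have := ih (α (FreeMonoid.of a * p * T)) ⟨⟨α (FreeMonoid.of a * p), map_mul _ _ _⟩, ?_⟩
      (FreeMonoid.of a * p * T) ((h * η S)⁻¹ * v) ?_ rfl
    · convert this using 1
      ext q
      simp only [Set.mem_ofPred_eq, map_mul, mul_assoc, eq_inv_mul_iff_mul_eq]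
    · rintro ⟨b, hb⟩
      obtain ⟨c, rfl⟩ := hsurj b
      refine hTst (hα.lStable (c := c) hv hp ?_)
      conv_rhs => rw [hb]
      simp only [map_mul, mul_assoc]
    · rw [mul_inv_cancel_left, edges_mul, hp, hv]
      exact Set.union_subset le_rfl hT

theorem UPol.of_context (hα : KernelDA η α) (hsurj : Function.Surjective α) (hC : ∅ ∈ C)
    (hX : X.Nonempty) (hW : ∀ h g, {w | edges η h w ⊆ X ∧ η w = g} ∈ C)
    (hIH : ∀ Y, Y ⊂ X → ∀ h g m, UPol C (fullLang η α Y h g m)) {h : H} (m : M)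
    (S : FreeMonoid A) (g : H) (hS : edges η h S ⊆ X) :
    UPol C {z | edges η (h * η S) z ⊆ X ∧ η z = g ∧ α S * α z = m} := by
  have hwf : WellFounded fun s' s : M => (∃ b, s' = s * b) ∧ ¬∃ b, s = s' * b :=
    wellFounded_strict (R := fun s' s : M => ∃ b, s' = s * b) (fun s => ⟨1, (mul_one s).symm⟩) (by
      rintro _ _ s ⟨b, rfl⟩ ⟨c, rfl⟩
      exact ⟨c * b, mul_assoc s c b⟩)
  generalize hs : α S = s
  induction s using hwf.induction generalizing S g with
  | _ s ih =>
  subst hs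
  by_cases hSst : RStable η α X (h * η S) (α S)
  · have := UPol.of_rStable hα hsurj hC hX hW hIH hS hSst m 1 g
      (by rw [edges_one]; exact Set.empty_subset _)
    simpa only [map_one, mul_one] using this
  · refine UPol.of_subset_edges hC hIH (f := fun x => α S * x = m)
      (UPol.of_edges_eq_left hC hX hIH _ _ (fun x => α S * x = m) fun p a hp => ?_)
    have := ih (α (S * (p * FreeMonoid.of a))) ⟨⟨α (p * FreeMonoid.of a), map_mul _ _ _⟩, ?_⟩
      (S * (p * FreeMonoid.of a)) ((η (p * FreeMonoid.of a))⁻¹ * g) ?_ rfl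
    · convert this using 1
      ext q
      simp only [Set.mem_ofPred_eq, map_mul, mul_assoc, eq_inv_mul_iff_mul_eq, mul_inv_rev]
    · rintro ⟨b, hb⟩
      obtain ⟨c, rfl⟩ := hsurj b
      refine hSst (hα.rStable (c := c) hp ?_)
      conv_rhs => rw [hb]
      simp only [map_mul, mul_assoc]
    · rw [edges_mul, hp]
      exact Set.union_subset hS le_rfl

theorem UPol.fullLang_mem (hα : KernelDA η α) (hsurj : Function.Surjective α) (hC : ∅ ∈ C)
    (hW : ∀ (X : Set (H × A)) h g, {w | edges η h w ⊆ X ∧ η w = g} ∈ C) (X : Set (H × A))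
    (h g : H) (m : M) : UPol C (fullLang η α X h g m) := by
  induction X using WellFoundedLT.induction generalizing h g m with
  | _ X hIH =>
  rcases X.eq_empty_or_nonempty with rfl | hX
  · by_cases hm : α 1 = m
    · refine UPol.base ?_
      convert hW ∅ h g using 1
      ext w
      simp only [fullLang, Set.mem_ofPred_eq, Set.subset_empty_iff]
      refine ⟨fun hw => ⟨hw.1, hw.2.1⟩, fun hw => ⟨hw.1, hw.2, ?_⟩⟩
      rw [eq_one_of_edges_eq_empty hw.1, hm]
    · convert UPol.base hC
      refine Set.eq_empty_of_forall_notMem fun w hw => hm ?_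
      rw [← hw.2.2, eq_one_of_edges_eq_empty hw.1]
  · refine UPol.of_edges_eq_left hC hX hIH h g (fun x => x = m) fun p a hp => ?_
    have := UPol.of_context hα hsurj hC hX (hW X) hIH m (p * FreeMonoid.of a)
      ((η (p * FreeMonoid.of a))⁻¹ * g) hp.le
    convert this using 1
    ext q
    simp only [Set.mem_ofPred_eq, map_mul, eq_inv_mul_iff_mul_eq]

end Decomposition

theorem BPol.isLatticeClass (C : LangClass A) : IsLatticeClass {K : Lang A | BPol C K} :=
  ⟨BPol.empty, BPol.univ, fun _ _ => BPol.union, fun _ _ => BPol.inter⟩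

theorem BPol.of_subset_edges [Finite A] {H : Type} [Group H] [Finite H] {η : FreeMonoid A →* H}
    {C : LangClass A} (huniv : (Set.univ : Lang A) ∈ C) (hη : ∀ F : Set H, η ⁻¹' F ∈ C)
    (X : Set (H × A)) (h g : H) : BPol C {w | edges η h w ⊆ X ∧ η w = g} := by
  have h1 : BPol C (⋂ e : {e : H × A // e ∉ X},
      (MarkedCat (η ⁻¹' {h⁻¹ * e.1.1}) e.1.2 Set.univ)ᶜ) :=
    (BPol.isLatticeClass C).iInter_mem _ fun e =>
      BPol.compl (BPol.base (Pol.mcat _ (Pol.base (hη _)) (Pol.base huniv)))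
  convert BPol.inter h1 (BPol.base (Pol.base (hη {g}))) using 1
  ext w
  refine and_congr ?_ Iff.rfl
  simp only [Set.mem_iInter, Set.mem_compl_iff, Subtype.forall]
  constructor
  · rintro hw e he ⟨p, hp, q, -, rfl⟩
    refine he (hw ⟨p, q, rfl, ?_⟩)
    rw [show η p = h⁻¹ * e.1 from hp, mul_inv_cancel_left]
  · rintro hw e ⟨p, q, h2, h3⟩
    by_contra he
    exact hw e he ⟨p, by rw [← h3]; simp, q, Set.mem_univ _, h2⟩

theorem IsGroupPrevariety.exists_morphism {G : LangClass A} (hG : IsGroupPrevariety G)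
    {K : Lang A} (hK : K ∈ G) : ∃ (H : Type) (_ : Group H) (_ : Finite H)
      (η : FreeMonoid A →* H), (∀ F : Set H, η ⁻¹' F ∈ G) ∧
        ∀ w, η w = 1 → (w ∈ K ↔ 1 ∈ K) := by
  obtain ⟨G₀, _, _, φ, F, hF⟩ := hG.2 K hK
  have hφ : ∀ u v, φ u = φ v → synCon K u v := by
    intro u v huv x y
    simp only [hF, Set.mem_preimage, map_mul, huv]
  have hfin : Finite (synCon K).Quotient := by
    refine Finite.of_surjective
      (fun x : Set.range φ => ((x.2.choose : FreeMonoid A) : (synCon K).Quotient)) ?_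
    intro q
    induction q using Con.induction_on with
    | _ w => exact ⟨⟨φ w, w, rfl⟩, (Con.eq _).2 (hφ _ _ (⟨w, rfl⟩ : ∃ u, φ u = φ w).choose_spec)⟩
  let inst : Group (synCon K).Quotient :=
    { (inferInstance : Monoid (synCon K).Quotient) with
      inv := fun x => x ^ (Nat.card G₀ - 1)
      inv_mul_cancel := by
        intro x
        change x ^ (Nat.card G₀ - 1) * x = 1
        rw [← pow_succ, Nat.sub_add_cancel Nat.card_pos]
        induction x using Con.induction_on with
        | _ w =>
          refine (((synCon K).mk'.map_pow w _).symm.trans ?_ :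
            (synCon K).mk' w ^ Nat.card G₀ = (synCon K).mk' 1)
          refine (Con.eq _).2 (hφ _ _ ?_)
          rw [map_pow, pow_card_eq_one', map_one] }
  refine ⟨(synCon K).Quotient, inst, hfin, (synCon K).mk', fun S => ?_, fun w hw => ?_⟩
  · have h1 : (⋃ q : S, (synCon K).mk' ⁻¹' {q.1}) ∈ G := by
      refine hG.1.1.1.iUnion_mem _ ?_
      rintro ⟨q, hq⟩
      induction q using Con.induction_on with
      | _ u =>
        convert hG.1.synCon_class_mem hK u using 1
        ext w
        exact Con.eq _
    convert h1 using 1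
    ext w
    simp
  · have h1 : synCon K w 1 := (Con.eq _).1 hw
    simpa using synCon_iff.1 h1 1 1

theorem IsGroupPrevariety.exists_morphism_gKernel {G : LangClass A} (hG : IsGroupPrevariety G)
    {M : Type} [Monoid M] [Finite M] (α : FreeMonoid A →* M) :
    ∃ (H : Type) (_ : Group H) (_ : Finite H) (η : FreeMonoid A →* H),
      (∀ F : Set H, η ⁻¹' F ∈ G) ∧ ∀ w, η w = 1 → α w ∈ gKernel G α := by
  have hsep : ∀ s : {s // s ∉ gKernel G α}, ∃ K ∈ G, Separates K ({1} : Lang A) (α ⁻¹' {s.1}) :=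
    fun s => not_not.1 s.2
  choose K hK hsep using hsep
  obtain ⟨H, hH, hfin, η, hη, hker⟩ := hG.exists_morphism (hG.1.1.1.iInter_mem K hK)
  refine ⟨H, hH, hfin, η, hη, fun w hw => ?_⟩
  by_contra hs
  have h1 : w ∈ ⋂ s, K s :=
    (hker w hw).2 (Set.mem_iInter.2 fun s => (hsep s).1 (Set.mem_singleton _))
  exact Set.notMem_empty w ((hsep ⟨α w, hs⟩).2 ▸ ⟨Set.mem_iInter.1 h1 ⟨α w, hs⟩, rfl⟩)

/-- for a prevariety of group languages `G`, a regular language belongs to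
`UPol (BPol G)` iff the `G`-kernel of its syntactic morphism belongs to `DA`, i.e.
`(st)^ω = (st)^ω · t · (st)^ω` for all `s, t` in this kernel. -/
theorem upol_bpol_group_da {A : Type} [Fintype A] (G : LangClass A)
    (hG : IsGroupPrevariety G) (L : Lang A) (hL : IsRegularLang L)
    {M : Type} [Monoid M] [Finite M] (α : FreeMonoid A →* M)
    (hα : IsSyntacticMorphism L α) :
    UPol {K : Lang A | BPol G K} L ↔
      ∀ s ∈ gKernel G α, ∀ t ∈ gKernel G α,
        ∀ e : M, IsIdempotentPower (s * t) e → e = e * t * e := by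
  refine ⟨fun h s hs t ht e he => (h.flex hG.1).da hα hs ht he, fun hDA => ?_⟩
  obtain ⟨H, _, _, η, hη, hker⟩ := hG.exists_morphism_gKernel α
  have hα' : KernelDA η α := fun u v hu hv n hn he =>
    hDA _ (hker u hu) _ (hker v hv) _ ⟨he, n, hn, rfl⟩
  have hC : (∅ : Lang A) ∈ {K : Lang A | BPol G K} := BPol.empty
  have hfull := UPol.fullLang_mem hα' hα.1 hC
    (fun X h g => BPol.of_subset_edges hG.1.1.1.2.1 hη X h g)
  have := UPol.iUnion hC
    (fun i : Set (H × A) × H × {m // m ∈ α '' L} => fullLang η α i.1 1 i.2.1 i.2.2)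
    (fun i => hfull _ _ _ _) ?_
  · convert this using 1
    ext w
    simp only [Set.mem_iUnion]
    constructor
    · exact fun hw => ⟨⟨edges η 1 w, η w, α w, w, hw, rfl⟩, rfl, rfl, rfl⟩
    · rintro ⟨⟨X, g, m, u, hu, rfl⟩, -, -, hw⟩
      have := (hα.2 w u).1 hw 1 1
      simp only [one_mul, mul_one] at this
      exact this.2 hu
  · rintro ⟨X, g, m, hm⟩ ⟨X', g', m', hm'⟩ w ⟨h1, h2, h3⟩ ⟨h1', h2', h3'⟩
    dsimp only at h1 h2 h3 h1' h2' h3'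
    subst h1 h2 h3 h1' h2' h3'
    rfl

end RegLang
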